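/- Let K ⊆ 𝕊_d be a closed A(𝔹_d)-totally null set. Then there exists a function φ ∈ A(𝔹_d) such that Z({φ}) = K, i.e., K = {z ∈ cl(𝔹_d) : φ(z) = 0}. -/

import Mathlib

open MeasureTheory Metric Set Filter Topology

noncomputable section

abbrev CB (d : ℕ) : Set (EuclideanSpace ℂ (Fin d)) := Metric.closedBall 0 1

instance (d : ℕ) : CompactSpace (CB d) :=
  isCompact_iff_compactSpace.mp (isCompact_closedBall _ _)

instance (d : ℕ) : MeasurableSpace (EuclideanSpace ℂ (Fin d)) := borel _

instance (d : ℕ) : BorelSpace (EuclideanSpace ℂ (Fin d)) := ⟨rfl⟩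

def polyAlg (d : ℕ) : Subalgebra ℂ C(CB d, ℂ) :=
  Algebra.adjoin ℂ
    { f : C(CB d, ℂ) | ∃ i : Fin d,
        f = ⟨fun z => (z : EuclideanSpace ℂ (Fin d)) i,
             (EuclideanSpace.proj (𝕜 := ℂ) i).continuous.comp continuous_subtype_val⟩ }

def ballAlgSub (d : ℕ) : Subalgebra ℂ C(CB d, ℂ) := (polyAlg d).topologicalClosure

def ballAlg (d : ℕ) : Set C(CB d, ℂ) := ballAlgSub d

def sphereD (d : ℕ) : Set (CB d) := {z | ‖(z : EuclideanSpace ℂ (Fin d))‖ = 1}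

def openD (d : ℕ) : Set (CB d) := {z | ‖(z : EuclideanSpace ℂ (Fin d))‖ < 1}

def ZS (d : ℕ) (S : Set C(CB d, ℂ)) : Set (CB d) := {z | ∀ φ ∈ S, φ z = 0}

def IX (d : ℕ) (X : Set (CB d)) : Set C(CB d, ℂ) :=
  {φ | φ ∈ ballAlg d ∧ ∀ z ∈ X, φ z = 0}

def IsZeroSet (d : ℕ) (X : Set (CB d)) : Prop :=
  ∃ S ⊆ ballAlg d, X = ZS d S

/-- A representing measure for a point of the closed ball: a finite positive regular
Borel measure integrating every function of the ball algebra to its value at the point. -/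
def IsRepMeasure (d : ℕ) (lam : CB d) (μ : Measure (CB d)) : Prop :=
  IsFiniteMeasure μ ∧ μ.Regular ∧ ∀ φ ∈ ballAlg d, φ lam = ∫ z, φ z ∂μ

/-- `X̂₀` : `X₀` together with all points of the open ball having a representing measure
supported on `X₀`. -/
def hatSet (d : ℕ) (X0 : Set (CB d)) : Set (CB d) :=
  X0 ∪ {lam | lam ∈ openD d ∧
    ∃ μ : Measure (CB d), IsRepMeasure d lam μ ∧ μ X0ᶜ = 0}

/-- `z` is an isolated point of the set `A`. -/
def IsIsolatedIn (d : ℕ) (A : Set (CB d)) (z : CB d) : Prop :=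
  z ∈ A ∧ ∃ U : Set (CB d), IsOpen U ∧ U ∩ A = {z}

/-- A closed ideal of the ball algebra. -/
structure IsClosedIdeal (d : ℕ) (J : Set C(CB d, ℂ)) : Prop where
  subset : J ⊆ ballAlg d
  closed : IsClosed J
  zero_mem : (0 : C(CB d, ℂ)) ∈ J
  add_mem : ∀ f ∈ J, ∀ g ∈ J, f + g ∈ J
  smul_mem : ∀ (c : ℂ), ∀ f ∈ J, c • f ∈ J
  mul_mem : ∀ f ∈ ballAlg d, ∀ g ∈ J, f * g ∈ J

/-- An `A(𝔹_d)`-Henkin (finite positive regular Borel) measure on the sphere. -/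
def IsHenkin (d : ℕ) (μ : Measure (CB d)) : Prop :=
  IsFiniteMeasure μ ∧ μ.Regular ∧ μ (sphereD d)ᶜ = 0 ∧
    ∀ f : ℕ → C(CB d, ℂ), (∀ n, f n ∈ ballAlg d) → (∃ C : ℝ, ∀ n, ‖f n‖ ≤ C) →
      (∀ z ∈ openD d, Tendsto (fun n => f n z) atTop (𝓝 0)) →
      Tendsto (fun n => ∫ z, f n z ∂μ) atTop (𝓝 0)

/-- An `A(𝔹_d)`-totally null subset of the sphere. -/
def IsTotallyNull (d : ℕ) (K : Set (CB d)) : Prop :=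
  K ⊆ sphereD d ∧ ∀ μ : Measure (CB d), IsHenkin d μ → μ K = 0

/-- A complex regular Borel measure on the sphere, given by its polar decomposition:
total variation `var` (a finite positive regular Borel measure concentrated on the
sphere) and a unimodular density. -/
structure CMeasure (d : ℕ) where
  var : Measure (CB d)
  density : CB d → ℂ
  finite : IsFiniteMeasure var
  regular : var.Regular
  measurable_density : Measurable density
  norm_density : ∀ z, ‖density z‖ = 1
  onSphere : var (sphereD d)ᶜ = 0

/-- Integral of a continuous function against a complex measure. -/
def cInt (d : ℕ) (μ : CMeasure d) (φ : C(CB d, ℂ)) : ℂ :=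
  ∫ z, φ z * μ.density z ∂μ.var

/-- An `A(𝔹_d)`-Henkin complex measure on the sphere. -/
def IsHenkinC (d : ℕ) (μ : CMeasure d) : Prop :=
  ∀ f : ℕ → C(CB d, ℂ), (∀ n, f n ∈ ballAlg d) → (∃ C : ℝ, ∀ n, ‖f n‖ ≤ C) →
    (∀ z ∈ openD d, Tendsto (fun n => f n z) atTop (𝓝 0)) →
    Tendsto (fun n => cInt d μ (f n)) atTop (𝓝 0)

/-- An `A(𝔹_d)`-totally singular complex measure: its total variation is mutually
singular with that of every Henkin complex measure. -/
def IsTotallySingularC (d : ℕ) (μ : CMeasure d) : Prop :=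
  ∀ ν : CMeasure d, IsHenkinC d ν → μ.var ⟂ₘ ν.var

/-- An `A(𝔹_d)`-totally null Borel subset of the sphere (complex-measure version). -/
def IsTotallyNullC (d : ℕ) (K : Set (CB d)) : Prop :=
  K ⊆ sphereD d ∧ ∀ μ : CMeasure d, IsHenkinC d μ → μ.var K = 0


section Duality

variable {X : Type*} [MetricSpace X] [CompactSpace X] [MeasurableSpace X] [BorelSpace X]

/-- A functional on `C(X, ℝ)` which is nonnegative on the functions nonnegative on the closed
set `T` is integration against a finite measure concentrated on `T`. -/
lemma exists_measure_of_nonneg_on {T : Set X} (hT : IsClosed T) (Λ : C(X, ℝ) →ₗ[ℝ] ℝ)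
    (hΛ : ∀ a : C(X, ℝ), (∀ x ∈ T, 0 ≤ a x) → 0 ≤ Λ a) :
    ∃ μ : Measure X, IsFiniteMeasure μ ∧ μ Tᶜ = 0 ∧ ∀ a : C(X, ℝ), ∫ x, a x ∂μ = Λ a := by
  let Λ' : CompactlySupportedContinuousMap X ℝ →ₗ[ℝ] ℝ :=
    { toFun := fun f => Λ f.toContinuousMap
      map_add' := fun f g => Λ.map_add _ _
      map_smul' := fun r f => Λ.map_smul _ _ }
  let Λp := PositiveLinearMap.mk₀ Λ' (fun f hf => hΛ _ (fun x _ => CompactlySupportedContinuousMap.le_def.1 hf x))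
  have hint : ∀ a : C(X, ℝ), ∫ x, a x ∂(RealRMK.rieszMeasure Λp) = Λ a := fun a =>
    RealRMK.integral_rieszMeasure Λp
      { toContinuousMap := a, hasCompactSupport' := HasCompactSupport.of_compactSpace _ }
  refine ⟨RealRMK.rieszMeasure Λp, inferInstance, ?_, hint⟩
  set μ := RealRMK.rieszMeasure Λp
  have hzero : ∀ a : C(X, ℝ), (∀ x ∈ T, a x = 0) → ∫ x, a x ∂μ = 0 := by
    intro a ha
    rw [hint a]
    have h1 := hΛ a (fun x hx => (ha x hx).ge)
    have h2 := hΛ (-a) (fun x hx => by simp [ha x hx])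
    rw [map_neg] at h2
    linarith
  rcases T.eq_empty_or_nonempty with rfl | hne
  · have := hzero 1 (by simp)
    simpa [Measure.real, ENNReal.toReal_eq_zero_iff] using this
  · let a : C(X, ℝ) := ⟨fun x => Metric.infDist x T, Metric.continuous_infDist_pt T⟩
    have h0 := hzero a (fun x hx => Metric.infDist_zero_of_mem hx)
    have hi : Integrable (fun x => a x) μ :=
      a.continuous.integrable_of_hasCompactSupport (HasCompactSupport.of_compactSpace _)
    rw [integral_eq_zero_iff_of_nonneg (f := fun x => a x) (fun x => Metric.infDist_nonneg) hi]
      at h0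
    refine measure_mono_null (fun x hx => ?_) h0
    intro hx0
    exact hx ((hT.mem_iff_infDist_zero hne).2 hx0)

/-- Solvability of finitely many strict linear inequalities by an element of a subspace of
`C(X, ℂ)`: if there is no solution, then there is an obstruction made of measures. -/
lemma exists_measures_of_not_exists {ι : Type*} [Fintype ι] (V : Submodule ℂ C(X, ℂ))
    (T : ι → Set X) (hT : ∀ i, IsClosed (T i)) (c : ι → ℂ) (s : ι → ℝ)
    (h : ¬ ∃ F ∈ V, ∀ i, ∀ x ∈ T i, s i < (c i * F x).re) :
    ∃ μ : ι → Measure X, (∀ i, IsFiniteMeasure (μ i)) ∧ (∀ i, μ i (T i)ᶜ = 0) ∧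
      (∀ F ∈ V, ∑ i, c i * ∫ x, F x ∂(μ i) = 0) ∧
      ∀ t : ι → ℝ, (∀ i, s i < t i) → 0 < ∑ i, t i * (μ i).real univ := by
  classical
  let O : Set (ι → C(X, ℝ)) := {a | ∀ i, ∀ x ∈ T i, s i < a i x}
  let W : Set (ι → C(X, ℝ)) := {a | ∃ F ∈ V, ∀ i x, a i x = (c i * F x).re}
  have hO : IsOpen O := by
    have : O = ⋂ i, (fun a : ι → C(X, ℝ) => a i) ⁻¹' {f | MapsTo f (T i) (Ioi (s i))} := by
      ext a; simp [O, MapsTo]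
    rw [this]
    exact isOpen_iInter_of_finite fun i =>
      (ContinuousMap.isOpen_setOfPred_mapsTo (hT i).isCompact isOpen_Ioi).preimage (continuous_apply i)
  have hOc : Convex ℝ O := by
    intro a ha b hb r q hr hq hrq i x hx
    exact convex_Ioi (s i) (ha i x hx) (hb i x hx) hr hq hrq
  have hWs : ∀ r : ℝ, ∀ a ∈ W, r • a ∈ W := by
    rintro r a ⟨F, hF, ha⟩
    refine ⟨(r : ℂ) • F, V.smul_mem _ hF, fun i x => ?_⟩
    simp only [Pi.smul_apply, ContinuousMap.smul_apply, smul_eq_mul, ha, Complex.mul_re,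
      Complex.mul_im, Complex.ofReal_re, Complex.ofReal_im]
    ring
  have hWc : Convex ℝ W := by
    intro a ha b hb r q _ _ _
    obtain ⟨F, hF, h1⟩ := hWs r a ha
    obtain ⟨G, hG, h2⟩ := hWs q b hb
    refine ⟨F + G, V.add_mem hF hG, fun i x => ?_⟩
    rw [Pi.add_apply, ContinuousMap.add_apply, h1, h2, ContinuousMap.add_apply, mul_add,
      Complex.add_re]
  have hdisj : Disjoint O W := by
    rw [Set.disjoint_left]
    rintro a ha ⟨F, hF, haF⟩
    exact h ⟨F, hF, fun i x hx => haF i x ▸ ha i x hx⟩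
  obtain ⟨f, u, hfO, hfW⟩ := geometric_hahn_banach_open hOc hO hWc hdisj
  have hu : u ≤ 0 := by
    have := hfW 0 ⟨0, V.zero_mem, by simp⟩
    simpa using this
  have hfW0 : ∀ a ∈ W, f a = 0 := by
    intro a ha
    by_contra hne
    have := hfW _ (hWs ((u - 1) / f a) a ha)
    rw [map_smul, smul_eq_mul, div_mul_cancel₀ _ hne] at this
    linarith
  have hpos : ∀ a : ι → C(X, ℝ), (∀ i, ∀ x ∈ T i, 0 ≤ a i x) → f a ≤ 0 := by
    intro a ha
    by_contra! hfa
    let o : ι → C(X, ℝ) := fun i => ContinuousMap.const X (s i + 1)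
    have ho : ∀ r : ℝ, 0 ≤ r → o + r • a ∈ O := by
      intro r hr i x hx
      have := mul_nonneg hr (ha i x hx)
      simp only [o, Pi.add_apply, Pi.smul_apply, ContinuousMap.add_apply,
        ContinuousMap.smul_apply, smul_eq_mul, ContinuousMap.const_apply]
      linarith
    have h1 := hfO _ (ho (|f o| / f a) (by positivity))
    rw [map_add, map_smul, smul_eq_mul, div_mul_cancel₀ _ hfa.ne'] at h1
    linarith [neg_abs_le (f o)]
  let Λ : ι → C(X, ℝ) →ₗ[ℝ] ℝ := fun i =>
    -((f : (ι → C(X, ℝ)) →ₗ[ℝ] ℝ) ∘ₗ LinearMap.single ℝ (fun _ => C(X, ℝ)) i)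
  have hΛ : ∀ a : ι → C(X, ℝ), ∑ i, Λ i (a i) = - f a := by
    intro a
    have : a = ∑ i, Pi.single i (a i) := (Finset.univ_sum_single a).symm
    conv_rhs => rw [this, map_sum]
    simp [Λ]
  have hex := fun i => exists_measure_of_nonneg_on (hT i) (Λ i) (by
    intro a ha
    have := hpos (Pi.single i a) (by
      intro j x hx
      rcases eq_or_ne j i with rfl | hji
      · simpa using ha x hx
      · simp [hji])
    simpa [Λ] using this)
  choose μ hμ hμT hμi using hex
  refine ⟨μ, hμ, hμT, ?_, ?_⟩
  · have hre : ∀ F ∈ V, (∑ i, c i * ∫ x, F x ∂(μ i)).re = 0 := by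
      intro F hF
      let a : ι → C(X, ℝ) := fun i =>
        ⟨fun x => (c i * F x).re, by fun_prop⟩
      have ha := hfW0 a ⟨F, hF, fun i x => rfl⟩
      rw [← neg_eq_zero, ← hΛ] at ha
      rw [Complex.re_sum, ← ha]
      refine Finset.sum_congr rfl fun i _ => ?_
      rw [← hμi i (a i), ← integral_const_mul]
      exact (integral_re (𝕜 := ℂ) (((continuous_const.mul F.continuous).integrable_of_hasCompactSupport
        (HasCompactSupport.of_compactSpace _)))).symm
    intro F hF
    refine Complex.ext (hre F hF) ?_
    have := hre ((-Complex.I) • F) (V.smul_mem _ hF)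
    simp only [ContinuousMap.smul_apply, smul_eq_mul, integral_const_mul] at this
    have h2 : ∑ i, c i * (-Complex.I * ∫ x, F x ∂(μ i))
        = -Complex.I * ∑ i, c i * ∫ x, F x ∂(μ i) := by
      rw [Finset.mul_sum]; exact Finset.sum_congr rfl fun i _ => by ring
    rw [h2] at this
    simpa using this
  · intro t ht
    have h1 := hfO (fun i => ContinuousMap.const X (t i)) (fun i x _ => ht i)
    have h2 := hΛ (fun i => ContinuousMap.const X (t i))
    have h3 : ∑ i, t i * (μ i).real univ = ∑ i, Λ i (ContinuousMap.const X (t i)) :=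
      Finset.sum_congr rfl fun i _ => by rw [← hμi]; simp [mul_comm]
    rw [h3, h2]
    linarith

end Duality

section Polynomials

variable {d : ℕ}

/-- The polynomial function on `ℂ^d` given by a multivariate polynomial. -/
def polyFun (p : MvPolynomial (Fin d) ℂ) (z : EuclideanSpace ℂ (Fin d)) : ℂ :=
  MvPolynomial.eval (fun i => z i) p

/-- The derivative of a polynomial at `w` in the direction `v`. -/
def polyDeriv (p : MvPolynomial (Fin d) ℂ) (v w : EuclideanSpace ℂ (Fin d)) : ℂ :=
  ∑ i, v i * polyFun (MvPolynomial.pderiv i p) w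

lemma continuous_polyFun (p : MvPolynomial (Fin d) ℂ) : Continuous (polyFun p) := by
  unfold polyFun
  exact (MvPolynomial.continuous_eval p).comp (by fun_prop)

lemma continuous_polyDeriv (p : MvPolynomial (Fin d) ℂ) (v : EuclideanSpace ℂ (Fin d)) :
    Continuous (polyDeriv p v) := by
  unfold polyDeriv
  exact continuous_finsetSum _ fun i _ => continuous_const.mul (continuous_polyFun _)

lemma polyDeriv_single (p : MvPolynomial (Fin d) ℂ) (j : Fin d) (w : EuclideanSpace ℂ (Fin d)) :
    polyDeriv p (EuclideanSpace.single j 1) w = polyFun (MvPolynomial.pderiv j p) w := by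
  classical
  unfold polyDeriv
  rw [Finset.sum_eq_single j]
  · simp
  · intro i _ hij
    simp [hij]
  · simp

lemma polyDeriv_sub_smul (p : MvPolynomial (Fin d) ℂ) (c : ℂ) (u v w : EuclideanSpace ℂ (Fin d)) :
    polyDeriv p (u - c • v) w = polyDeriv p u w - c * polyDeriv p v w := by
  unfold polyDeriv
  rw [Finset.mul_sum, ← Finset.sum_sub_distrib]
  refine Finset.sum_congr rfl fun i _ => ?_
  simp
  ring

lemma hasFDerivAt_polyFun (p : MvPolynomial (Fin d) ℂ) (z : EuclideanSpace ℂ (Fin d)) :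
    HasFDerivAt (polyFun p)
      (∑ i, polyFun (MvPolynomial.pderiv i p) z • (EuclideanSpace.proj i : EuclideanSpace ℂ (Fin d) →L[ℂ] ℂ))
      z := by
  classical
  induction p using MvPolynomial.induction_on with
  | C a =>
    have e1 : polyFun (MvPolynomial.C a) = fun _ : EuclideanSpace ℂ (Fin d) => a := by
      ext w; simp [polyFun]
    rw [e1]
    refine (hasFDerivAt_const (𝕜 := ℂ) a z).congr_fderiv ?_
    ext v
    simp [polyFun]
  | add p q hp hq =>
    have := hp.add hq
    have e1 : polyFun (p + q) = polyFun p + polyFun q := by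
      ext w; simp [polyFun]
    rw [e1]
    refine this.congr_fderiv ?_
    ext v
    simp [polyFun, Finset.sum_add_distrib, add_mul]
  | mul_X p j hp =>
    have hX : HasFDerivAt (fun z : EuclideanSpace ℂ (Fin d) => z j)
        ((EuclideanSpace.proj j : EuclideanSpace ℂ (Fin d) →L[ℂ] ℂ)) z :=
      (EuclideanSpace.proj j : EuclideanSpace ℂ (Fin d) →L[ℂ] ℂ).hasFDerivAt
    have h := hp.mul hX
    have e1 : polyFun (p * MvPolynomial.X j) = polyFun p * fun z => z j := by
      ext w; simp [polyFun]
    rw [e1]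
    refine h.congr_fderiv ?_
    ext v
    simp only [add_apply, smul_apply, sum_apply, smul_eq_mul, polyFun, Derivation.leibniz,
      MvPolynomial.pderiv_X, map_add, map_mul, MvPolynomial.eval_X, add_mul,
      Finset.sum_add_distrib, Finset.mul_sum]
    congr 1
    · rw [Finset.sum_eq_single j]
      · simp
      · intro i _ hij
        simp [hij.symm]
      · simp
    · exact Finset.sum_congr rfl fun i _ => by ring

lemma hasDerivAt_polyFun_line (p : MvPolynomial (Fin d) ℂ) (v w : EuclideanSpace ℂ (Fin d))
    (x : ℂ) :
    HasDerivAt (fun x : ℂ => polyFun p (w + x • v)) (polyDeriv p v (w + x • v)) x := by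
  have h1 : HasDerivAt (fun x : ℂ => w + x • v) v x := by
    simpa using ((hasDerivAt_id x).smul_const v).const_add w
  refine ((hasFDerivAt_polyFun p (w + x • v)).comp_hasDerivAt x h1).congr_deriv ?_
  simp [polyDeriv, mul_comm]

lemma exists_polyFun_eq_integral (p : MvPolynomial (Fin d) ℂ) :
    ∃ q : MvPolynomial (Fin d) ℂ, ∀ z, polyFun q z = ∫ t in (0 : ℝ)..1, polyFun p ((t : ℂ) • z) := by
  induction p using MvPolynomial.induction_on' with
  | monomial a c =>
    refine ⟨MvPolynomial.monomial a (c / ((∑ i, a i : ℕ) + 1)), fun z => ?_⟩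
    have hprod : ∀ f : Fin d → ℂ, (a.prod fun i e => f i ^ e) = ∏ i, f i ^ a i := fun f =>
      Finsupp.prod_fintype _ _ fun i => pow_zero _
    have h : ∀ t : ℝ, polyFun (MvPolynomial.monomial a c) ((t : ℂ) • z)
        = ((t ^ (∑ i, a i) : ℝ) : ℂ) * (c * ∏ i, z i ^ a i) := by
      intro t
      rw [polyFun, MvPolynomial.eval_monomial, hprod]
      simp only [PiLp.smul_apply, smul_eq_mul, mul_pow, Finset.prod_mul_distrib,
        Finset.prod_pow_eq_pow_sum]
      push_cast
      ring
    simp_rw [h]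
    rw [intervalIntegral.integral_mul_const, intervalIntegral.integral_ofReal, integral_pow]
    simp only [polyFun, MvPolynomial.eval_monomial, hprod]
    push_cast
    simp
    ring
  | add p q hp hq =>
    obtain ⟨p', hp⟩ := hp
    obtain ⟨q', hq⟩ := hq
    have hc : ∀ (p : MvPolynomial (Fin d) ℂ) (z : EuclideanSpace ℂ (Fin d)),
        IntervalIntegrable (fun t : ℝ => polyFun p ((t : ℂ) • z)) volume 0 1 := fun p z =>
      ((continuous_polyFun p).comp (by fun_prop)).intervalIntegrable _ _
    refine ⟨p' + q', fun z => ?_⟩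
    have e : ∀ (p q : MvPolynomial (Fin d) ℂ) z, polyFun (p + q) z = polyFun p z + polyFun q z :=
      fun p q z => by simp [polyFun]
    simp_rw [e]
    rw [intervalIntegral.integral_add (hc p z) (hc q z), hp, hq]

/-- Derivatives at the center of a disc of a bounded pointwise null sequence tend to zero. -/
lemma tendsto_deriv_zero {φ : ℕ → ℂ → ℂ} (hφ : ∀ n, Differentiable ℂ (φ n)) {ρ C : ℝ} (hρ : 0 < ρ)
    (hC : ∀ n, ∀ ζ ∈ sphere (0 : ℂ) ρ, ‖φ n ζ‖ ≤ C)
    (h0 : ∀ ζ ∈ sphere (0 : ℂ) ρ, Tendsto (fun n => φ n ζ) atTop (𝓝 0)) :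
    Tendsto (fun n => deriv (φ n) 0) atTop (𝓝 0) := by
  have hd : ∀ n, deriv (φ n) 0 = (2 * Real.pi * Complex.I : ℂ)⁻¹ •
      ∮ z in C(0, ρ), ((z - 0) ^ 2)⁻¹ • φ n z := fun n =>
    (Complex.two_pi_I_inv_smul_circleIntegral_sub_sq_inv_smul_of_differentiable isOpen_univ
      (subset_univ _) (hφ n).differentiableOn (mem_ball_self hρ)).symm
  simp_rw [hd]
  suffices h : Tendsto (fun n => ∮ z in C(0, ρ), ((z - 0) ^ 2)⁻¹ • φ n z) atTop
      (𝓝 (∫ _ in (0 : ℝ)..(2 * Real.pi), (0 : ℂ))) by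
    rw [intervalIntegral.integral_zero] at h
    simpa only [smul_zero] using h.const_smul (2 * Real.pi * Complex.I : ℂ)⁻¹
  unfold circleIntegral
  have hmem : ∀ θ : ℝ, circleMap 0 ρ θ ∈ sphere (0 : ℂ) ρ := fun θ =>
    circleMap_mem_sphere 0 hρ.le θ
  have hn : ∀ θ : ℝ, ‖circleMap 0 ρ θ‖ = ρ := fun θ => by simpa using hmem θ
  have hne : ∀ θ : ℝ, circleMap 0 ρ θ ≠ 0 := fun θ h => by
    have := hn θ
    rw [h, norm_zero] at this
    exact hρ.ne this
  refine intervalIntegral.tendsto_integral_filter_of_dominated_convergence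
    (fun _ => ρ * ((ρ ^ 2)⁻¹ * C)) ?_ ?_ intervalIntegrable_const ?_
  · refine Eventually.of_forall fun n => Continuous.aestronglyMeasurable ?_
    simp only [deriv_circleMap, sub_zero]
    have h1 : Continuous fun θ : ℝ => circleMap 0 ρ θ := continuous_circleMap 0 ρ
    exact (h1.mul continuous_const).smul
      (((h1.pow 2).inv₀ fun θ => pow_ne_zero 2 (hne θ)).smul ((hφ n).continuous.comp h1))
  · refine Eventually.of_forall fun n => Eventually.of_forall fun θ _ => ?_
    rw [norm_smul, norm_smul, norm_inv, norm_pow, sub_zero, deriv_circleMap, norm_mul, hn,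
      Complex.norm_I, mul_one]
    gcongr
    exact hC n _ (hmem θ)
  · refine Eventually.of_forall fun θ _ => ?_
    have h1 := ((h0 _ (hmem θ)).const_mul (((circleMap 0 ρ θ - 0) ^ 2)⁻¹)).const_mul
      (deriv (circleMap 0 ρ) θ)
    rwa [mul_zero, mul_zero] at h1

/-- A sequence of polynomials bounded on the closed unit ball and tending to zero pointwise on
the open unit ball. -/
structure IsBoundedNull (P : ℕ → MvPolynomial (Fin d) ℂ) (C : ℝ) : Prop where
  bound : ∀ n z, ‖z‖ ≤ 1 → ‖polyFun (P n) z‖ ≤ C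
  null : ∀ z, ‖z‖ < 1 → Tendsto (fun n => polyFun (P n) z) atTop (𝓝 0)

lemma norm_polyDeriv_le {p : MvPolynomial (Fin d) ℂ} {C : ℝ}
    (hp : ∀ z, ‖z‖ ≤ 1 → ‖polyFun p z‖ ≤ C) {v w : EuclideanSpace ℂ (Fin d)}
    {ρ : ℝ} (hρ : 0 < ρ) (hvw : ∀ ζ : ℂ, ‖ζ‖ = ρ → ‖w + ζ • v‖ < 1) :
    ‖polyDeriv p v w‖ ≤ C / ρ := by
  have hd := (hasDerivAt_polyFun_line p v w 0).deriv
  rw [zero_smul, add_zero] at hd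
  rw [← hd]
  refine Complex.norm_deriv_le_of_forall_mem_sphere_norm_le hρ ?_ ?_
  · exact Differentiable.diffContOnCl fun x => (hasDerivAt_polyFun_line p v w x).differentiableAt
  · intro ζ hζ
    exact hp _ (hvw ζ (by simpa using hζ)).le

lemma IsBoundedNull.tendsto_polyDeriv {P : ℕ → MvPolynomial (Fin d) ℂ} {C : ℝ}
    (hP : IsBoundedNull P C) {v w : EuclideanSpace ℂ (Fin d)}
    {ρ : ℝ} (hρ : 0 < ρ) (hvw : ∀ ζ : ℂ, ‖ζ‖ = ρ → ‖w + ζ • v‖ < 1) :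
    Tendsto (fun n => polyDeriv (P n) v w) atTop (𝓝 0) := by
  have hd := fun n => (hasDerivAt_polyFun_line (P n) v w 0).deriv
  simp only [zero_smul, add_zero] at hd
  simp_rw [← hd]
  refine tendsto_deriv_zero (fun n x => (hasDerivAt_polyFun_line (P n) v w x).differentiableAt)
    hρ (C := C) ?_ ?_
  · intro n ζ hζ
    exact hP.bound n _ (hvw ζ (by simpa using hζ)).le
  · intro ζ hζ
    exact hP.null _ (hvw ζ (by simpa using hζ))

end Polynomials

section Toeplitz

variable {d : ℕ}

lemma intervalIntegrable_inv_sqrt_one_sub :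
    IntervalIntegrable (fun t : ℝ => (√(1 - t))⁻¹) volume 0 1 := by
  have h : IntervalIntegrable (fun t : ℝ => (√t)⁻¹) volume 0 1 := by
    refine (intervalIntegral.intervalIntegrable_rpow' (r := -(1 / 2)) (by norm_num)).congr ?_
    intro t ht
    rw [uIoc_of_le zero_le_one] at ht
    simp only [Real.sqrt_eq_rpow, Real.rpow_neg ht.1.le]
  simpa using (h.comp_sub_left 1).symm

/-- Complex discs centered on a radius and tangent to the sphere stay in the open unit ball. -/
lemma norm_add_smul_tangent_lt_one {z : EuclideanSpace ℂ (Fin d)} (hz : ‖z‖ = 1) (j : Fin d)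
    {t : ℝ} (ht0 : 0 < t) (ht1 : t < 1) {ζ : ℂ} (hζ : ‖ζ‖ = √(1 - t)) :
    ‖(t : ℂ) • z + ζ • (EuclideanSpace.single j 1 - star (z j) • z)‖ < 1 := by
  set τ : EuclideanSpace ℂ (Fin d) := EuclideanSpace.single j 1 - star (z j) • z with hτ
  have hin : inner ℂ z τ = 0 := by
    rw [hτ, inner_sub_right, inner_smul_right, inner_self_eq_norm_sq_to_K, hz,
      EuclideanSpace.inner_single_right]
    simp
  have hpyth : ∀ a b : ℂ, ‖a • z + b • τ‖ ^ 2 = ‖a‖ ^ 2 + ‖b‖ ^ 2 * ‖τ‖ ^ 2 := by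
    intro a b
    have : inner ℂ (a • z) (b • τ) = 0 := by
      rw [inner_smul_left, inner_smul_right, hin]; simp
    have h := norm_add_sq (𝕜 := ℂ) (a • z) (b • τ)
    rw [this, norm_smul, norm_smul, hz] at h
    rw [h]
    simp [mul_pow]
  have hτ1 : ‖τ‖ ^ 2 ≤ 1 := by
    have h := hpyth (star (z j)) 1
    have e : star (z j) • z + (1 : ℂ) • τ = EuclideanSpace.single j 1 := by
      rw [hτ]; simp
    rw [e] at h
    simp only [PiLp.norm_single, norm_one, one_pow, one_mul] at h
    nlinarith [sq_nonneg ‖star (z j)‖]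
  have h := hpyth t ζ
  rw [hζ, Real.sq_sqrt (by linarith), Complex.norm_real, Real.norm_of_nonneg ht0.le] at h
  have h2 : ‖(t : ℂ) • z + ζ • τ‖ ^ 2 < 1 := by
    rw [h]; nlinarith
  exact (sq_lt_one_iff₀ (norm_nonneg _)).1 h2

lemma integral_polyDeriv_tangent (p : MvPolynomial (Fin d) ℂ) (j : Fin d)
    (z : EuclideanSpace ℂ (Fin d)) :
    ∫ t in (0 : ℝ)..1, polyDeriv p (EuclideanSpace.single j 1 - star (z j) • z) ((t : ℂ) • z)
      = (∫ t in (0 : ℝ)..1, polyFun (MvPolynomial.pderiv j p) ((t : ℂ) • z))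
        - star (z j) * (polyFun p z - polyFun p 0) := by
  have hi : ∀ v, IntervalIntegrable (fun t : ℝ => polyDeriv p v ((t : ℂ) • z)) volume 0 1 :=
    fun v => ((continuous_polyDeriv p v).comp (by fun_prop)).intervalIntegrable _ _
  have hftc : ∫ t in (0 : ℝ)..1, polyDeriv p z ((t : ℂ) • z) = polyFun p z - polyFun p 0 := by
    rw [intervalIntegral.integral_eq_sub_of_hasDerivAt (f := fun t : ℝ => polyFun p ((t : ℂ) • z))
      _ (hi z)]
    · simp
    · intro t _
      simpa using (hasDerivAt_polyFun_line p z 0 (t : ℂ)).comp_ofReal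
  simp_rw [polyDeriv_sub_smul]
  rw [intervalIntegral.integral_sub (hi _) ((hi z).const_mul _),
    intervalIntegral.integral_const_mul, hftc]
  simp_rw [polyDeriv_single]

/-- Multiplication by a conjugate coordinate preserves bounded null sequences of polynomials, up
to a bounded pointwise null error. -/
lemma IsBoundedNull.exists_conj {P : ℕ → MvPolynomial (Fin d) ℂ} {C : ℝ}
    (hP : IsBoundedNull P C) (j : Fin d) :
    ∃ (Q : ℕ → MvPolynomial (Fin d) ℂ) (C' : ℝ), IsBoundedNull Q C' ∧ ∀ z, ‖z‖ ≤ 1 →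
      Tendsto (fun n => star (z j) * polyFun (P n) z - polyFun (Q n) z) atTop (𝓝 0) := by
  have : Nonempty (Fin d) := ⟨j⟩
  choose Q hQ using fun n => exists_polyFun_eq_integral (MvPolynomial.pderiv j (P n))
  have hC0 : 0 ≤ C := (norm_nonneg _).trans (hP.bound 0 0 (by simp))
  have hae : ∀ᵐ t : ℝ, t ≠ 1 := (Set.countable_singleton (1 : ℝ)).ae_notMem volume
  have hnull : ∀ z : EuclideanSpace ℂ (Fin d), ‖z‖ < 1 →
      Tendsto (fun n => polyFun (Q n) z) atTop (𝓝 0) := by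
    intro z hz
    have hρ : 0 < (1 - ‖z‖) / 2 := by linarith
    have hlt : ∀ t ∈ uIoc (0 : ℝ) 1, ∀ ζ : ℂ, ‖ζ‖ = (1 - ‖z‖) / 2 →
        ‖(t : ℂ) • z + ζ • EuclideanSpace.single j (1 : ℂ)‖ < 1 := by
      intro t ht ζ hζ
      rw [uIoc_of_le zero_le_one] at ht
      refine (norm_add_le _ _).trans_lt ?_
      rw [norm_smul, norm_smul, hζ, Complex.norm_real, Real.norm_of_nonneg ht.1.le]
      simp only [PiLp.norm_single, norm_one, mul_one]
      nlinarith [ht.2, norm_nonneg z]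
    simp_rw [hQ, ← polyDeriv_single]
    rw [← intervalIntegral.integral_zero (E := ℂ) (μ := volume) (a := 0) (b := 1)]
    refine intervalIntegral.tendsto_integral_filter_of_dominated_convergence
      (fun _ => C / ((1 - ‖z‖) / 2)) ?_ ?_ intervalIntegrable_const ?_
    · exact Eventually.of_forall fun n =>
        ((continuous_polyDeriv _ _).comp (by fun_prop)).aestronglyMeasurable
    · exact Eventually.of_forall fun n => Eventually.of_forall fun t ht =>
        norm_polyDeriv_le (hP.bound n) hρ (hlt t ht)
    · exact Eventually.of_forall fun t ht => hP.tendsto_polyDeriv hρ (hlt t ht)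
  have hid : ∀ n z, star (z j) * polyFun (P n) z - polyFun (Q n) z = star (z j) * polyFun (P n) 0
      - ∫ t in (0 : ℝ)..1,
        polyDeriv (P n) (EuclideanSpace.single j 1 - star (z j) • z) ((t : ℂ) • z) := by
    intro n z
    rw [integral_polyDeriv_tangent, hQ]
    ring
  have hbd : ∀ n z, ‖z‖ = 1 → ∀ᵐ t : ℝ, t ∈ uIoc (0 : ℝ) 1 →
      ‖polyDeriv (P n) (EuclideanSpace.single j 1 - star (z j) • z) ((t : ℂ) • z)‖
        ≤ C * (√(1 - t))⁻¹ := by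
    intro n z hz
    filter_upwards [hae] with t ht1 ht
    rw [uIoc_of_le zero_le_one] at ht
    have ht1 : t < 1 := lt_of_le_of_ne ht.2 ht1
    rw [← div_eq_mul_inv]
    exact norm_polyDeriv_le (hP.bound n) (Real.sqrt_pos.2 (by linarith))
      (fun ζ hζ => norm_add_smul_tangent_lt_one hz j ht.1 ht1 hζ)
  have hzj : ∀ z : EuclideanSpace ℂ (Fin d), ‖z‖ ≤ 1 → ‖star (z j)‖ ≤ 1 := fun z hz => by
    rw [norm_star]; exact (PiLp.norm_apply_le z j).trans hz
  have hP0 : Tendsto (fun n => polyFun (P n) 0) atTop (𝓝 0) := hP.null 0 (by simp)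
  have hsphere : ∀ z : EuclideanSpace ℂ (Fin d), ‖z‖ = 1 →
      Tendsto (fun n => star (z j) * polyFun (P n) z - polyFun (Q n) z) atTop (𝓝 0) := by
    intro z hz
    simp_rw [hid]
    have h1 : Tendsto (fun n => ∫ t in (0 : ℝ)..1,
        polyDeriv (P n) (EuclideanSpace.single j 1 - star (z j) • z) ((t : ℂ) • z)) atTop
        (𝓝 (∫ _ in (0 : ℝ)..1, (0 : ℂ))) := by
      refine intervalIntegral.tendsto_integral_filter_of_dominated_convergence
        (fun t => C * (√(1 - t))⁻¹) ?_ ?_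
        (intervalIntegrable_inv_sqrt_one_sub.const_mul C) ?_
      · exact Eventually.of_forall fun n =>
          ((continuous_polyDeriv _ _).comp (by fun_prop)).aestronglyMeasurable
      · exact Eventually.of_forall fun n => hbd n z hz
      · filter_upwards [hae] with t ht1 ht
        rw [uIoc_of_le zero_le_one] at ht
        have ht1 : t < 1 := lt_of_le_of_ne ht.2 ht1
        exact hP.tendsto_polyDeriv (Real.sqrt_pos.2 (by linarith))
          (fun ζ hζ => norm_add_smul_tangent_lt_one hz j ht.1 ht1 hζ)
    rw [intervalIntegral.integral_zero] at h1
    simpa using (hP0.const_mul (star (z j))).sub h1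
  let I : ℝ := ∫ t in (0 : ℝ)..1, C * (√(1 - t))⁻¹
  have hQs : ∀ n z, ‖z‖ = 1 → ‖polyFun (Q n) z‖ ≤ C + (C + I) := by
    intro n z hz
    have h1 : polyFun (Q n) z = star (z j) * polyFun (P n) z
        - (star (z j) * polyFun (P n) z - polyFun (Q n) z) := by ring
    have hm : ∀ w : EuclideanSpace ℂ (Fin d), ‖w‖ ≤ 1 → ‖star (z j) * polyFun (P n) w‖ ≤ C := by
      intro w hw
      rw [norm_mul]
      exact (mul_le_of_le_one_left (norm_nonneg _) (hzj z hz.le)).trans (hP.bound n w hw)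
    rw [h1]
    refine (norm_sub_le _ _).trans (add_le_add (hm z hz.le) ?_)
    rw [hid]
    refine (norm_sub_le _ _).trans (add_le_add (hm 0 (by simp)) ?_)
    refine intervalIntegral.norm_integral_le_of_norm_le zero_le_one ?_
      (intervalIntegrable_inv_sqrt_one_sub.const_mul C)
    simpa only [uIoc_of_le (zero_le_one (α := ℝ))] using hbd n z hz
  refine ⟨Q, C + (C + I), ⟨fun n z hz => ?_, hnull⟩, fun z hz => ?_⟩
  · refine Complex.norm_le_of_forall_mem_frontier_norm_le
      (U := ball (0 : EuclideanSpace ℂ (Fin d)) 1) isBounded_ball ?_ ?_ ?_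
    · exact Differentiable.diffContOnCl fun x => (hasFDerivAt_polyFun (Q n) x).differentiableAt
    · intro w hw
      rw [frontier_ball _ one_ne_zero] at hw
      exact hQs n w (by simpa using hw)
    · rw [closure_ball _ one_ne_zero]
      simpa using hz
  · rcases hz.lt_or_eq with hz | hz
    · simpa using ((hP.null z hz).const_mul (star (z j))).sub (hnull z hz)
    · exact hsphere z hz

end Toeplitz

section Henkin

variable {d : ℕ}

/-- The coordinate functions on the closed ball. -/
def coordFun (j : Fin d) : C(CB d, ℂ) :=
  ⟨fun z => (z : EuclideanSpace ℂ (Fin d)) j,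
    (EuclideanSpace.proj (𝕜 := ℂ) j).continuous.comp continuous_subtype_val⟩

lemma coordFun_apply (j : Fin d) (z : CB d) :
    coordFun j z = (z : EuclideanSpace ℂ (Fin d)) j := rfl

lemma polyAlg_eq : polyAlg d = Algebra.adjoin ℂ (range (coordFun (d := d))) := by
  unfold polyAlg
  congr 1
  ext f
  simp only [mem_range, eq_comm]
  rfl

lemma mem_polyAlg_iff {f : C(CB d, ℂ)} :
    f ∈ polyAlg d ↔ ∃ p : MvPolynomial (Fin d) ℂ, ∀ z : CB d, f z = polyFun p z := by
  have h : ∀ (p : MvPolynomial (Fin d) ℂ) (z : CB d),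
      MvPolynomial.aeval (coordFun (d := d)) p z = polyFun p z := by
    intro p z
    induction p using MvPolynomial.induction_on with
    | C a => simp [polyFun]
    | add p q hp hq => simp_all [polyFun]
    | mul_X p j hp =>
      rw [map_mul, ContinuousMap.mul_apply, hp, MvPolynomial.aeval_X]
      simp [polyFun, coordFun_apply]
  rw [polyAlg_eq, Algebra.adjoin_range_eq_range_aeval]
  constructor
  · rintro ⟨p, rfl⟩
    exact ⟨p, h p⟩
  · rintro ⟨p, hp⟩
    exact ⟨p, ContinuousMap.ext fun z => (h p z).trans (hp z).symm⟩

lemma coordFun_mem_polyAlg (j : Fin d) : coordFun j ∈ polyAlg d := by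
  rw [polyAlg_eq]
  exact Algebra.subset_adjoin (mem_range_self j)

/-- A bounded sequence of polynomials on the closed ball, tending to zero pointwise on the open
ball. -/
structure IsPolyNull (f : ℕ → C(CB d, ℂ)) : Prop where
  mem : ∀ n, f n ∈ polyAlg d
  bound : ∃ C : ℝ, ∀ n, ‖f n‖ ≤ C
  null : ∀ z ∈ openD d, Tendsto (fun n => f n z) atTop (𝓝 0)

lemma IsPolyNull.coord_mul {f : ℕ → C(CB d, ℂ)} (hf : IsPolyNull f) (j : Fin d) :
    IsPolyNull fun n => coordFun j * f n := by
  obtain ⟨C, hC⟩ := hf.bound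
  refine ⟨fun n => mul_mem (coordFun_mem_polyAlg j) (hf.mem n), ⟨‖coordFun j‖ * C, fun n => ?_⟩,
    fun z hz => ?_⟩
  · exact (norm_mul_le _ _).trans (mul_le_mul_of_nonneg_left (hC n) (norm_nonneg _))
  · simpa using (hf.null z hz).const_mul (coordFun j z)

lemma IsPolyNull.exists_conj {f : ℕ → C(CB d, ℂ)} (hf : IsPolyNull f) (j : Fin d) :
    ∃ h : ℕ → C(CB d, ℂ), IsPolyNull h ∧
      ∀ z, Tendsto (fun n => star (coordFun j z) * f n z - h n z) atTop (𝓝 0) := by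
  obtain ⟨C, hC⟩ := hf.bound
  choose P hP using fun n => mem_polyAlg_iff.1 (hf.mem n)
  have hPn : IsBoundedNull P C := by
    refine ⟨fun n z hz => ?_, fun z hz => ?_⟩
    · have hz' : z ∈ CB d := by simpa using hz
      rw [← hP n ⟨z, hz'⟩]
      exact ((f n).norm_coe_le_norm _).trans (hC n)
    · have hz' : z ∈ CB d := by simpa using hz.le
      have := hf.null ⟨z, hz'⟩ hz
      simpa only [hP] using this
  obtain ⟨Q, C', hQ, hPQ⟩ := hPn.exists_conj j
  have hC' : 0 ≤ C' := (norm_nonneg _).trans (hQ.bound 0 0 (by simp))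
  have hle : ∀ z : CB d, ‖(z : EuclideanSpace ℂ (Fin d))‖ ≤ 1 := fun z =>
    mem_closedBall_zero_iff.1 z.2
  let h : ℕ → C(CB d, ℂ) := fun n =>
    ⟨fun z => polyFun (Q n) z, (continuous_polyFun (Q n)).comp continuous_subtype_val⟩
  refine ⟨h, ⟨fun n => mem_polyAlg_iff.2 ⟨Q n, fun z => rfl⟩, ⟨C', fun n => ?_⟩, fun z hz => ?_⟩,
    fun z => ?_⟩
  · exact (ContinuousMap.norm_le _ hC').2 fun z => hQ.bound n z (hle z)
  · exact hQ.null z hz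
  · refine (hPQ z (hle z)).congr fun n => ?_
    rw [hP]
    rfl

lemma tendsto_zero_of_forall_approx {u : ℕ → ℂ}
    (h : ∀ ε > 0, ∃ v : ℕ → ℂ, Tendsto v atTop (𝓝 0) ∧ ∀ n, ‖u n - v n‖ ≤ ε) :
    Tendsto u atTop (𝓝 0) := by
  rw [Metric.tendsto_atTop]
  intro ε hε
  obtain ⟨v, hv, huv⟩ := h (ε / 2) (by positivity)
  obtain ⟨N, hN⟩ := Metric.tendsto_atTop.1 hv (ε / 2) (by positivity)
  refine ⟨N, fun n hn => ?_⟩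
  have h1 := hN n hn
  rw [dist_zero_right] at h1 ⊢
  calc ‖u n‖ = ‖(u n - v n) + v n‖ := by ring_nf
    _ ≤ ‖u n - v n‖ + ‖v n‖ := norm_add_le _ _
    _ < ε := by linarith [huv n]

variable {ι : Type*} [Fintype ι] (μ : ι → Measure (CB d)) (c : ι → ℂ)

lemma integrable_continuousMap (ν : Measure (CB d)) [IsFiniteMeasure ν] (g : C(CB d, ℂ)) :
    Integrable (fun z => g z) ν :=
  g.continuous.integrable_of_hasCompactSupport (HasCompactSupport.of_compactSpace _)

lemma integrable_mul_continuousMap (ν : Measure (CB d)) [IsFiniteMeasure ν] (f g : C(CB d, ℂ)) :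
    Integrable (fun z => f z * g z) ν :=
  integrable_continuousMap ν (f * g)

/-- `g` times a combination of measures acts continuously on bounded null sequences of
polynomials. -/
def ActsNull (g : C(CB d, ℂ)) : Prop :=
  ∀ f : ℕ → C(CB d, ℂ), IsPolyNull f →
    Tendsto (fun n => ∑ i, c i * ∫ z, g z * f n z ∂(μ i)) atTop (𝓝 0)

variable {μ c}

lemma ActsNull.coord_mul {g : C(CB d, ℂ)} (hg : ActsNull μ c g) (j : Fin d) :
    ActsNull μ c (coordFun j * g) := by
  intro f hf
  refine (hg _ (hf.coord_mul j)).congr fun n => ?_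
  refine Finset.sum_congr rfl fun i _ => ?_
  congr 2
  ext z
  simp only [ContinuousMap.mul_apply]
  ring

lemma norm_sum_integral_sub_le [∀ i, IsFiniteMeasure (μ i)] {a b : C(CB d, ℂ)} {r : ℝ}
    (h : ∀ z, ‖a z - b z‖ ≤ r) :
    ‖∑ i, c i * ∫ z, a z ∂(μ i) - ∑ i, c i * ∫ z, b z ∂(μ i)‖
      ≤ (∑ i, ‖c i‖ * (μ i).real univ) * r := by
  rw [← Finset.sum_sub_distrib, Finset.sum_mul]
  refine norm_sum_le_of_le _ fun i _ => ?_
  rw [← mul_sub, ← integral_sub (integrable_continuousMap _ a) (integrable_continuousMap _ b),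
    norm_mul, mul_assoc]
  gcongr
  refine (norm_integral_le_of_norm_le_const (C := r) (Eventually.of_forall h)).trans_eq ?_
  ring

lemma ActsNull.conj_mul [∀ i, IsFiniteMeasure (μ i)] {g : C(CB d, ℂ)} (hg : ActsNull μ c g)
    (j : Fin d) : ActsNull μ c (star (coordFun j) * g) := by
  intro f hf
  obtain ⟨C, hC⟩ := hf.bound
  obtain ⟨h, hh, hfh⟩ := hf.exists_conj j
  obtain ⟨C', hC'⟩ := hh.bound
  have key : Tendsto (fun n => ∑ i, c i * ∫ z, g z * (star (coordFun j z) * f n z - h n z) ∂(μ i))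
      atTop (𝓝 0) := by
    rw [← Finset.sum_const_zero (s := (Finset.univ : Finset ι))]
    refine tendsto_finsetSum _ fun i _ => ?_
    have : Tendsto (fun n => ∫ z, g z * (star (coordFun j z) * f n z - h n z) ∂(μ i))
        atTop (𝓝 (∫ _, (0 : ℂ) ∂(μ i))) := by
      refine tendsto_integral_of_dominated_convergence
        (fun _ => ‖g‖ * (‖coordFun j‖ * C + C')) (fun n => ?_) (integrable_const _) (fun n => ?_) ?_
      · exact (integrable_continuousMap (μ i) (g * (star (coordFun j) * f n - h n))).1
      · refine Eventually.of_forall fun z => ?_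
        rw [norm_mul]
        refine mul_le_mul (g.norm_coe_le_norm z) ?_ (norm_nonneg _) (norm_nonneg _)
        refine (norm_sub_le _ _).trans (add_le_add ?_ (((h n).norm_coe_le_norm z).trans (hC' n)))
        rw [norm_mul, norm_star]
        exact mul_le_mul ((coordFun j).norm_coe_le_norm z)
          (((f n).norm_coe_le_norm z).trans (hC n)) (norm_nonneg _) (norm_nonneg _)
      · exact Eventually.of_forall fun z => by simpa using (hfh z).const_mul (g z)
    rw [integral_zero] at this
    simpa using this.const_mul (c i)
  have hsum := key.add (hg h hh)
  rw [add_zero] at hsum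
  refine hsum.congr fun n => ?_
  rw [← Finset.sum_add_distrib]
  refine Finset.sum_congr rfl fun i _ => ?_
  have hint : Integrable (fun z => g z * (star (coordFun j z) * f n z - h n z)) (μ i) :=
    integrable_continuousMap (μ i) (g * (star (coordFun j) * f n - h n))
  rw [← mul_add, ← integral_add hint (integrable_mul_continuousMap (μ i) g (h n))]
  congr 2
  ext z
  simp only [ContinuousMap.mul_apply, ContinuousMap.star_apply]
  ring

lemma actsNull_of_annihilates [∀ i, IsFiniteMeasure (μ i)]
    (hμ : ∀ F ∈ polyAlg d, ∑ i, c i * ∫ z, F z ∂(μ i) = 0) (g : C(CB d, ℂ)) :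
    ActsNull μ c g := by
  let A : StarSubalgebra ℂ C(CB d, ℂ) := StarAlgebra.adjoin ℂ (range (coordFun (d := d)))
  have hA : A.topologicalClosure = ⊤ := by
    refine ContinuousMap.starSubalgebra_topologicalClosure_eq_top_of_separatesPoints A ?_
    intro x y hxy
    obtain ⟨j, hj⟩ : ∃ j, (x : EuclideanSpace ℂ (Fin d)) j ≠ (y : EuclideanSpace ℂ (Fin d)) j := by
      by_contra! hall
      exact hxy (Subtype.ext (PiLp.ext hall))
    exact ⟨coordFun j, ⟨coordFun j, StarAlgebra.subset_adjoin ℂ _ (mem_range_self j), rfl⟩, hj⟩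
  have hmul : ∀ a ∈ Algebra.adjoin ℂ (range (coordFun (d := d)) ∪ star (range (coordFun (d := d)))),
      ∀ b, ActsNull μ c b → ActsNull μ c (a * b) := by
    intro a ha
    induction ha using Algebra.adjoin_induction with
    | mem x hx =>
      intro b hb
      rcases hx with ⟨j, rfl⟩ | hx
      · exact hb.coord_mul j
      · obtain ⟨j, hj⟩ := Set.mem_star.1 hx
        rw [← star_star x, ← hj]
        exact hb.conj_mul j
    | algebraMap r =>
      intro b hb f hf
      have := (hb f hf).const_mul r
      rw [mul_zero] at this
      refine this.congr fun n => ?_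
      rw [Finset.mul_sum]
      refine Finset.sum_congr rfl fun i _ => ?_
      rw [mul_left_comm, ← integral_const_mul]
      congr 2
      ext z
      simp [mul_assoc]
    | add x y _ _ hx hy =>
      intro b hb f hf
      have := (hx b hb f hf).add (hy b hb f hf)
      rw [add_zero] at this
      refine this.congr fun n => ?_
      rw [← Finset.sum_add_distrib]
      refine Finset.sum_congr rfl fun i _ => ?_
      rw [← mul_add, ← integral_add (integrable_mul_continuousMap (μ i) (x * b) (f n))
        (integrable_mul_continuousMap (μ i) (y * b) (f n))]
      congr 2
      ext z
      simp only [ContinuousMap.mul_apply, ContinuousMap.add_apply]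
      ring
    | mul x y _ _ hx hy =>
      intro b hb
      rw [mul_assoc]
      exact hx _ (hy b hb)
  have hone : ActsNull μ c 1 := by
    intro f hf
    have h0 : ∀ n, ∑ i, c i * ∫ z, (1 : C(CB d, ℂ)) z * f n z ∂(μ i) = 0 := fun n => by
      simpa using hμ _ (hf.mem n)
    simp_rw [h0]
    exact tendsto_const_nhds
  intro f hf
  obtain ⟨C, hC⟩ := hf.bound
  have hC0 : 0 ≤ C := (norm_nonneg _).trans (hC 0)
  set M : ℝ := ∑ i, ‖c i‖ * (μ i).real univ with hM
  have hM0 : 0 ≤ M := Finset.sum_nonneg fun i _ => by positivity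
  refine tendsto_zero_of_forall_approx fun ε hε => ?_
  have hgA : g ∈ closure (A : Set C(CB d, ℂ)) := by
    rw [← StarSubalgebra.topologicalClosure_coe, hA]
    trivial
  obtain ⟨a, haA, ha⟩ := Metric.mem_closure_iff.1 hgA (ε / (M * C + 1)) (by positivity)
  have haN : ActsNull μ c a := by
    have := hmul a (by rwa [← StarAlgebra.adjoin_toSubalgebra]) 1 hone
    rwa [mul_one] at this
  refine ⟨_, haN f hf, fun n => ?_⟩
  refine (norm_sum_integral_sub_le (a := g * f n) (b := a * f n)
    (r := ε / (M * C + 1) * C) fun z => ?_).trans ?_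
  · rw [ContinuousMap.mul_apply, ContinuousMap.mul_apply, ← sub_mul, norm_mul]
    refine mul_le_mul ?_ (((f n).norm_coe_le_norm z).trans (hC n)) (norm_nonneg _) (by positivity)
    rw [dist_eq_norm] at ha
    exact ((g - a).norm_coe_le_norm z).trans ha.le
  · rw [← hM]
    calc M * (ε / (M * C + 1) * C) = ε * (M * C / (M * C + 1)) := by ring
      _ ≤ ε * 1 := by
        gcongr
        rw [div_le_one (by positivity)]
        linarith
      _ = ε := mul_one _

/-- Annihilating combinations of measures restrict on closed sets to combinations acting
continuously on bounded null sequences. -/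
lemma tendsto_setIntegral_of_annihilates [∀ i, IsFiniteMeasure (μ i)]
    (hμ : ∀ F ∈ polyAlg d, ∑ i, c i * ∫ z, F z ∂(μ i) = 0) {K : Set (CB d)} (hK : IsClosed K)
    (hKne : K.Nonempty) {f : ℕ → C(CB d, ℂ)} (hf : IsPolyNull f) :
    Tendsto (fun n => ∑ i, c i * ∫ z in K, f n z ∂(μ i)) atTop (𝓝 0) := by
  obtain ⟨C, hC⟩ := hf.bound
  let g : ℕ → C(CB d, ℂ) := fun k =>
    ⟨fun z => ((max 0 (1 - k * Metric.infDist z K) : ℝ) : ℂ), by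
      have := Metric.continuous_infDist_pt K
      fun_prop⟩
  let χ : CB d → ℂ := K.indicator 1
  have hχ : Measurable χ := measurable_one.indicator hK.measurableSet
  have hg1 : ∀ k z, ‖g k z‖ ≤ 1 := by
    intro k z
    simp only [g, ContinuousMap.coe_mk, Complex.norm_real]
    have : 0 ≤ (k : ℝ) * Metric.infDist z K := by positivity [Metric.infDist_nonneg (x := z) (s := K)]
    rw [Real.norm_of_nonneg (le_max_left _ _)]
    exact max_le zero_le_one (by linarith)
  have hχ1 : ∀ z, ‖χ z‖ ≤ 1 := by
    intro z
    by_cases hz : z ∈ K <;> simp [χ, hz]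
  have hgχ : ∀ z, Tendsto (fun k => g k z) atTop (𝓝 (χ z)) := by
    intro z
    by_cases hz : z ∈ K
    · simp [g, χ, hz, Metric.infDist_zero_of_mem hz]
    · have hpos : 0 < Metric.infDist z K := (hK.notMem_iff_infDist_pos hKne).1 hz
      have : ∀ᶠ k : ℕ in atTop, g k z = χ z := by
        filter_upwards [(tendsto_natCast_atTop_atTop (R := ℝ)).eventually_ge_atTop
          (1 / Metric.infDist z K)] with k hk
        rw [div_le_iff₀ hpos] at hk
        simp only [g, χ, ContinuousMap.coe_mk, indicator_of_notMem hz]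
        rw [max_eq_left (by linarith)]
        simp
      exact tendsto_const_nhds.congr' (this.mono fun k hk => hk.symm)
  have hint : Tendsto (fun k => ∑ i, ‖c i‖ * ∫ z, ‖χ z - g k z‖ * C ∂(μ i)) atTop (𝓝 0) := by
    rw [← Finset.sum_const_zero (s := (Finset.univ : Finset ι))]
    refine tendsto_finsetSum _ fun i _ => ?_
    have : Tendsto (fun k => ∫ z, ‖χ z - g k z‖ * C ∂(μ i)) atTop (𝓝 (∫ _, (0 : ℝ) ∂(μ i))) := by
      refine tendsto_integral_of_dominated_convergence (fun _ => 2 * |C|) (fun k => ?_)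
        (integrable_const _) (fun k => Eventually.of_forall fun z => ?_)
        (Eventually.of_forall fun z => ?_)
      · exact ((hχ.sub (g k).continuous.measurable).norm.mul_const C).aestronglyMeasurable
      · rw [norm_mul, norm_norm, Real.norm_eq_abs]
        gcongr
        exact (norm_sub_le _ _).trans (by linarith [hχ1 z, hg1 k z])
      · have := ((tendsto_const_nhds (x := χ z)).sub (hgχ z)).norm.mul_const C
        simpa using this
    rw [integral_zero] at this
    simpa using this.const_mul ‖c i‖
  refine tendsto_zero_of_forall_approx fun ε hε => ?_
  obtain ⟨k, hk⟩ := (hint.eventually_le_const hε).exists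
  refine ⟨_, actsNull_of_annihilates hμ (g k) f hf, fun n => ?_⟩
  refine le_trans ?_ hk
  rw [← Finset.sum_sub_distrib]
  refine norm_sum_le_of_le _ fun i _ => ?_
  have hχf : ∫ z in K, f n z ∂(μ i) = ∫ z, χ z * f n z ∂(μ i) := by
    rw [← integral_indicator hK.measurableSet]
    congr 1
    ext z
    by_cases hz : z ∈ K <;> simp [χ, hz]
  have hχi : Integrable (fun z => χ z * f n z) (μ i) :=
    (integrable_continuousMap (μ i) (f n)).bdd_mul hχ.aestronglyMeasurable
      (Eventually.of_forall hχ1)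
  rw [hχf, ← mul_sub, ← integral_sub hχi (integrable_mul_continuousMap (μ i) (g k) (f n)),
    norm_mul]
  gcongr
  refine norm_integral_le_of_norm_le ?_ (Eventually.of_forall fun z => ?_)
  · refine Integrable.mul_const ?_ C
    exact ((integrable_const (2 : ℝ)).mono' (hχ.sub (g k).continuous.measurable).norm.aestronglyMeasurable
      (Eventually.of_forall fun z => by
        rw [norm_norm]
        exact (norm_sub_le _ _).trans (by linarith [hχ1 z, hg1 k z])))
  · rw [← sub_mul, norm_mul]
    gcongr
    exact ((f n).norm_coe_le_norm z).trans (hC n)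

end Henkin

section PeakFunctions

variable {d : ℕ}

lemma exists_isPolyNull_approx {f : ℕ → C(CB d, ℂ)} (hf : ∀ n, f n ∈ ballAlg d)
    (hb : ∃ C : ℝ, ∀ n, ‖f n‖ ≤ C) (h0 : ∀ z ∈ openD d, Tendsto (fun n => f n z) atTop (𝓝 0)) :
    ∃ p : ℕ → C(CB d, ℂ), IsPolyNull p ∧ ∀ n, ‖f n - p n‖ ≤ 1 / ((n : ℝ) + 1) := by
  obtain ⟨C, hC⟩ := hb
  have hex : ∀ n, ∃ p ∈ polyAlg d, ‖f n - p‖ ≤ 1 / ((n : ℝ) + 1) := by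
    intro n
    have hn : f n ∈ closure (polyAlg d : Set C(CB d, ℂ)) := by
      rw [← Subalgebra.topologicalClosure_coe]
      exact hf n
    obtain ⟨p, hp, hfp⟩ := Metric.mem_closure_iff.1 hn (1 / ((n : ℝ) + 1)) (by positivity)
    exact ⟨p, hp, by rw [← dist_eq_norm]; exact hfp.le⟩
  choose p hp hfp using hex
  refine ⟨p, ⟨hp, ⟨C + 1, fun n => ?_⟩, fun z hz => ?_⟩, hfp⟩
  · have h1 : (1 : ℝ) / ((n : ℝ) + 1) ≤ 1 := by
      rw [div_le_one (by positivity)]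
      linarith [n.cast_nonneg (α := ℝ)]
    calc ‖p n‖ = ‖f n - (f n - p n)‖ := by rw [sub_sub_cancel]
      _ ≤ ‖f n‖ + ‖f n - p n‖ := norm_sub_le _ _
      _ ≤ C + 1 := add_le_add (hC n) ((hfp n).trans h1)
  · have hd : Tendsto (fun n => (f n - p n) z) atTop (𝓝 0) :=
      squeeze_zero_norm (fun n => ((f n - p n).norm_coe_le_norm z).trans (hfp n))
        tendsto_one_div_add_atTop_nhds_zero_nat
    simpa using (h0 z hz).sub hd

lemma isHenkin_of_forall_isPolyNull {ν : Measure (CB d)} [IsFiniteMeasure ν]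
    (hν : ν (sphereD d)ᶜ = 0)
    (h : ∀ p : ℕ → C(CB d, ℂ), IsPolyNull p → Tendsto (fun n => ∫ z, p n z ∂ν) atTop (𝓝 0)) :
    IsHenkin d ν := by
  refine ⟨inferInstance, inferInstance, hν, fun f hf hb h0 => ?_⟩
  obtain ⟨p, hp, hfp⟩ := exists_isPolyNull_approx hf hb h0
  have hsub : Tendsto (fun n => ∫ z, (f n z - p n z) ∂ν) atTop (𝓝 0) := by
    refine squeeze_zero_norm (a := fun n : ℕ => 1 / ((n : ℝ) + 1) * ν.real univ) (fun n => ?_) ?_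
    · exact norm_integral_le_of_norm_le_const (Eventually.of_forall fun z =>
        ((f n - p n).norm_coe_le_norm z).trans (hfp n))
    · simpa using (tendsto_one_div_add_atTop_nhds_zero_nat (𝕜 := ℝ)).mul_const (ν.real univ)
  have := hsub.add (h p hp)
  rw [add_zero] at this
  refine this.congr fun n => ?_
  rw [integral_sub (integrable_continuousMap ν _) (integrable_continuousMap ν _), sub_add_cancel]

lemma exists_mem_polyAlg_re {K T : Set (CB d)} (hK : IsClosed K) (hKne : K.Nonempty)
    (hTN : IsTotallyNull d K) (hT : IsClosed T) (hKT : Disjoint K T) {ε : ℝ} (hε : 0 < ε) :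
    ∃ F ∈ polyAlg d, (∀ z, -ε < (F z).re) ∧ (∀ z ∈ K, 1 < (F z).re) ∧
      ∀ z ∈ T, |(F z).re| < ε ∧ |(F z).im| < ε := by
  by_contra hcon
  have hex : ¬ ∃ F ∈ Subalgebra.toSubmodule (polyAlg d), ∀ i : Fin 5,
      ∀ x ∈ (![univ, K, T, T, T] : Fin 5 → Set (CB d)) i,
      (![-ε, 1, -ε, -ε, -ε] : Fin 5 → ℝ) i <
        ((![1, 1, -1, Complex.I, -Complex.I] : Fin 5 → ℂ) i * F x).re := by
    rintro ⟨F, hF, h⟩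
    refine hcon ⟨F, hF, fun z => ?_, fun z hz => ?_, fun z hz => ?_⟩
    · simpa using h 0 z trivial
    · simpa using h 1 z hz
    · have h0 := h 0 z trivial
      have h2 := h 2 z hz
      have h3 := h 3 z hz
      have h4 := h 4 z hz
      simp at h0 h2 h3 h4
      exact ⟨abs_lt.2 ⟨h0, h2⟩, abs_lt.2 ⟨h4, h3⟩⟩
  obtain ⟨μ, hfin, hsupp, hann, hpos⟩ := exists_measures_of_not_exists _ _
    (by intro i; fin_cases i <;> simp [hK, hT]) _ _ hex
  have hann' : ∀ F ∈ polyAlg d,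
      ∑ i, (![1, 1, -1, Complex.I, -Complex.I] : Fin 5 → ℂ) i * ∫ z, F z ∂(μ i) = 0 := hann
  have hT0 : ∀ i, (![univ, K, T, T, T] : Fin 5 → Set (CB d)) i = T → (μ i).restrict K = 0 := by
    intro i hi
    rw [Measure.restrict_eq_zero]
    refine measure_mono_null ?_ (hsupp i)
    rw [hi]
    exact hKT.subset_compl_right
  have hHenkin : IsHenkin d ((μ 0 + μ 1).restrict K) := by
    refine isHenkin_of_forall_isPolyNull ?_ fun p hp => ?_
    · refine measure_mono_null (compl_subset_compl.2 hTN.1) ?_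
      rw [Measure.restrict_apply hK.measurableSet.compl, compl_inter_self, measure_empty]
    · refine (tendsto_setIntegral_of_annihilates hann' hK hKne hp).congr fun n => ?_
      rw [Measure.restrict_add, integral_add_measure (integrable_continuousMap _ _)
        (integrable_continuousMap _ _)]
      simp [Fin.sum_univ_five, hT0 2 rfl, hT0 3 rfl, hT0 4 rfl]
  have hμ1K : μ 1 K = 0 := by
    have := hTN.2 _ hHenkin
    rw [Measure.restrict_apply_self, Measure.add_apply, add_eq_zero] at this
    exact this.2
  have hμ1 : μ 1 univ = 0 := by
    rw [← union_compl_self K]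
    exact measure_union_null hμ1K (hsupp 1)
  have := hpos ![0, 2, 0, 0, 0] (by intro i; fin_cases i <;> simp [hε])
  simp [Fin.sum_univ_five, Measure.real, hμ1] at this

lemma exp_mem_ballAlg {f : C(CB d, ℂ)} (hf : f ∈ ballAlg d) :
    ∃ g ∈ ballAlg d, ∀ z, g z = Complex.exp (f z) := by
  refine ⟨NormedSpace.exp f, ?_, fun z => ?_⟩
  · exact NormedSpace.exp_mem (R := ℂ) (polyAlg d).isClosed_topologicalClosure hf
  · rw [Complex.exp_eq_exp_ℂ]
    exact NormedSpace.map_exp (ContinuousMap.evalAlgHom ℂ ℂ z) (continuous_eval_const z) f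

lemma const_mem_ballAlg (c : ℂ) : algebraMap ℂ C(CB d, ℂ) c ∈ ballAlg d :=
  (ballAlgSub d).algebraMap_mem c

lemma exists_multiplier {K T : Set (CB d)} (hK : IsClosed K) (hKne : K.Nonempty)
    (hTN : IsTotallyNull d K) (hT : IsClosed T) (hKT : Disjoint K T) {ε : ℝ} (hε : 0 < ε)
    (hε1 : ε ≤ 1) :
    ∃ q ∈ ballAlg d, (∀ z, ‖q z‖ ≤ 1) ∧ (∀ z ∈ K, ‖q z‖ ≤ 1 / 2) ∧ (∀ z, q z ≠ 0) ∧
      ∀ z ∈ T, ‖q z - 1‖ ≤ ε ∧ Real.exp (-ε) ≤ ‖q z‖ := by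
  obtain ⟨F, hF, hF0, hFK, hFT⟩ := exists_mem_polyAlg_re hK hKne hTN hT hKT
    (show 0 < ε / 6 by positivity)
  obtain ⟨q, hq, hqe⟩ := exp_mem_ballAlg (f := -(F + algebraMap ℂ C(CB d, ℂ) (ε / 6 : ℝ)))
    ((ballAlgSub d).neg_mem ((ballAlgSub d).add_mem
      ((polyAlg d).le_topologicalClosure hF) (const_mem_ballAlg _)))
  have hqe' : ∀ z, q z = Complex.exp (-(F z + (ε / 6 : ℝ))) := fun z => by
    rw [hqe]
    simp
  have hn : ∀ z, ‖q z‖ = Real.exp (-((F z).re + ε / 6)) := fun z => by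
    rw [hqe', Complex.norm_exp, Complex.neg_re, Complex.add_re, Complex.ofReal_re]
  refine ⟨q, hq, fun z => ?_, fun z hz => ?_, fun z => ?_, fun z hz => ⟨?_, ?_⟩⟩
  · rw [hn, Real.exp_le_one_iff]
    linarith [hF0 z]
  · rw [hn]
    calc Real.exp (-((F z).re + ε / 6)) ≤ Real.exp (-1) := Real.exp_le_exp.2 (by linarith [hFK z hz])
      _ ≤ 1 / 2 := by
        rw [Real.exp_neg, inv_eq_one_div]
        exact one_div_le_one_div_of_le two_pos (by linarith [Real.add_one_le_exp (1 : ℝ)])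
  · rw [hqe']
    exact Complex.exp_ne_zero _
  · obtain ⟨h1, h2⟩ := hFT z hz
    have h3 : ‖-(F z + (ε / 6 : ℝ))‖ ≤ ε / 2 := by
      rw [norm_neg]
      refine (norm_add_le _ _).trans ?_
      rw [Complex.norm_real, Real.norm_of_nonneg (by positivity)]
      linarith [Complex.norm_le_abs_re_add_abs_im (F z)]
    rw [hqe']
    refine (Complex.norm_exp_sub_one_le (h3.trans (by linarith))).trans (by linarith)
  · obtain ⟨h1, h2⟩ := hFT z hz
    rw [hn]
    exact Real.exp_le_exp.2 (by linarith [le_abs_self (F z).re])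

/-- The properties of the partial products whose limit vanishes exactly on `K`. -/
structure IsPartialProduct (K : Set (CB d)) (n : ℕ) (φ : C(CB d, ℂ)) : Prop where
  mem : φ ∈ ballAlg d
  le_one : ∀ z, ‖φ z‖ ≤ 1
  le_on : ∀ z ∈ K, ‖φ z‖ ≤ (1 / 2) ^ n
  ne_zero : ∀ z, φ z ≠ 0

lemma IsPartialProduct.exists_succ {K : Set (CB d)} (hK : IsClosed K) (hKne : K.Nonempty)
    (hTN : IsTotallyNull d K) {n : ℕ} {φ : C(CB d, ℂ)} (hφ : IsPartialProduct K n φ) :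
    ∃ ψ, IsPartialProduct K (n + 1) ψ ∧ (∀ z, ‖ψ z - φ z‖ ≤ 4 * (1 / 2) ^ n) ∧
      ∀ z, 1 / ((n : ℝ) + 1) ≤ infDist z K →
        Real.exp (-(1 / 2) ^ n) * ‖φ z‖ ≤ ‖ψ z‖ := by
  have hpow : (0 : ℝ) < (1 / 2) ^ n := by positivity
  let T : Set (CB d) := {z | 2 * (1 / 2) ^ n ≤ ‖φ z‖} ∪ {z | 1 / ((n : ℝ) + 1) ≤ infDist z K}
  have hT : IsClosed T := (isClosed_le continuous_const φ.continuous.norm).union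
    (isClosed_le continuous_const (continuous_infDist_pt K))
  have hKT : Disjoint K T := by
    rw [Set.disjoint_left]
    rintro z hz (h | h)
    · have := hφ.le_on z hz
      simp only [mem_ofPred_eq] at h
      linarith
    · simp only [mem_ofPred_eq, infDist_zero_of_mem hz] at h
      have : 0 < 1 / ((n : ℝ) + 1) := by positivity
      linarith
  obtain ⟨q, hq, hq1, hqK, hq0, hqT⟩ := exists_multiplier hK hKne hTN hT hKT hpow
    (pow_le_one₀ (by norm_num) (by norm_num))
  refine ⟨φ * q, ⟨(ballAlgSub d).mul_mem hφ.mem hq, fun z => ?_, fun z hz => ?_, fun z => ?_⟩,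
    fun z => ?_, fun z hz => ?_⟩
  · rw [ContinuousMap.mul_apply, norm_mul]
    exact mul_le_one₀ (hφ.le_one z) (norm_nonneg _) (hq1 z)
  · rw [ContinuousMap.mul_apply, norm_mul, pow_succ]
    exact mul_le_mul (hφ.le_on z hz) (hqK z hz) (norm_nonneg _) hpow.le
  · exact mul_ne_zero (hφ.ne_zero z) (hq0 z)
  · rw [ContinuousMap.mul_apply, ← mul_sub_one, norm_mul]
    by_cases hz : z ∈ T
    · calc ‖φ z‖ * ‖q z - 1‖ ≤ 1 * (1 / 2) ^ n :=
          mul_le_mul (hφ.le_one z) (hqT z hz).1 (norm_nonneg _) zero_le_one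
        _ ≤ 4 * (1 / 2) ^ n := by linarith
    · have h1 : ‖φ z‖ ≤ 2 * (1 / 2) ^ n := by
        by_contra! h
        exact hz (Or.inl h.le)
      have h2 : ‖q z - 1‖ ≤ 2 := by
        refine (norm_sub_le _ _).trans ?_
        rw [norm_one]
        linarith [hq1 z]
      calc ‖φ z‖ * ‖q z - 1‖ ≤ 2 * (1 / 2) ^ n * 2 :=
          mul_le_mul h1 h2 (norm_nonneg _) (by positivity)
        _ = 4 * (1 / 2) ^ n := by ring
  · rw [ContinuousMap.mul_apply, norm_mul, mul_comm]
    exact mul_le_mul_of_nonneg_left (hqT z (Or.inr hz)).2 (norm_nonneg _)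

lemma exists_seq_isPartialProduct {K : Set (CB d)} (hK : IsClosed K) (hKne : K.Nonempty)
    (hTN : IsTotallyNull d K) :
    ∃ φ : ℕ → C(CB d, ℂ), (∀ n, IsPartialProduct K n (φ n)) ∧
      (∀ (n : ℕ) z, ‖φ (n + 1) z - φ n z‖ ≤ 4 * (1 / 2) ^ n) ∧
      ∀ (n : ℕ) z, 1 / ((n : ℝ) + 1) ≤ infDist z K →
        Real.exp (-(1 / 2) ^ n) * ‖φ n z‖ ≤ ‖φ (n + 1) z‖ := by
  choose! next h1 h2 h3 using fun (n : ℕ) (φ : C(CB d, ℂ)) (hφ : IsPartialProduct K n φ) =>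
    hφ.exists_succ hK hKne hTN
  let φ : ℕ → C(CB d, ℂ) := fun n => Nat.rec 1 (fun n ψ => next n ψ) n
  have hφ : ∀ n, IsPartialProduct K n (φ n) := by
    intro n
    induction n with
    | zero =>
      refine ⟨(ballAlgSub d).one_mem, fun z => ?_, fun z _ => ?_, fun z => ?_⟩ <;> simp [φ]
    | succ n ih => exact h1 n _ ih
  exact ⟨φ, hφ, fun n => h2 n _ (hφ n), fun n => h3 n _ (hφ n)⟩

end PeakFunctions

/-- a closed totally null subset of the sphere is the zero set of a single
function of the ball algebra. -/
theorem stmt9 (d : ℕ) (hd : 1 ≤ d) (K : Set (CB d)) (hKc : IsClosed K)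
    (hTN : IsTotallyNull d K) :
    ∃ φ ∈ ballAlg d, {z : CB d | φ z = 0} = K := by
  rcases K.eq_empty_or_nonempty with rfl | hKne
  · exact ⟨1, (ballAlgSub d).one_mem, by ext z; simp⟩
  obtain ⟨φ, hφ, hstep, hlow⟩ := exists_seq_isPartialProduct hKc hKne hTN
  have hcauchy : CauchySeq φ := by
    refine cauchySeq_of_le_geometric (1 / 2) 4 (by norm_num) fun n => ?_
    rw [dist_comm, dist_eq_norm]
    exact (ContinuousMap.norm_le _ (by positivity)).2 fun z => hstep n z
  obtain ⟨ψ, hψ⟩ := cauchySeq_tendsto_of_complete hcauchy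
  have hψz : ∀ z, Tendsto (fun n => φ n z) atTop (𝓝 (ψ z)) := fun z =>
    ((continuous_eval_const z).tendsto ψ).comp hψ
  refine ⟨ψ, ?_, ?_⟩
  · exact (polyAlg d).isClosed_topologicalClosure.mem_of_tendsto hψ
      (Eventually.of_forall fun n => (hφ n).mem)
  ext z
  constructor
  · intro hz
    by_contra hzK
    have hpos : 0 < infDist z K := (hKc.notMem_iff_infDist_pos hKne).1 hzK
    obtain ⟨N, hN⟩ := exists_nat_one_div_lt hpos
    have hbound : ∀ k, Real.exp (-2) * (Real.exp (2 * (1 / 2) ^ k) * ‖φ N z‖) ≤ ‖φ (N + k) z‖ := by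
      intro k
      induction k with
      | zero =>
        rw [← mul_assoc, ← Real.exp_add]
        simp
      | succ k ih =>
        have hNk : 1 / (((N + k : ℕ) : ℝ) + 1) ≤ infDist z K := by
          refine le_trans ?_ hN.le
          refine one_div_le_one_div_of_le (by positivity) ?_
          push_cast
          linarith [k.cast_nonneg (α := ℝ)]
        refine le_trans ?_ (hlow (N + k) z hNk)
        have hpow : ((1 : ℝ) / 2) ^ (N + k) ≤ (1 / 2) ^ k :=
          pow_le_pow_of_le_one (by norm_num) (by norm_num) (Nat.le_add_left k N)
        calc Real.exp (-2) * (Real.exp (2 * (1 / 2) ^ (k + 1)) * ‖φ N z‖)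
            = Real.exp (-(1 / 2) ^ k) *
              (Real.exp (-2) * (Real.exp (2 * (1 / 2) ^ k) * ‖φ N z‖)) := by
              rw [← mul_assoc, ← mul_assoc, ← mul_assoc, ← Real.exp_add, ← Real.exp_add,
                ← Real.exp_add]
              congr 2
              ring
          _ ≤ Real.exp (-(1 / 2) ^ (N + k)) * ‖φ (N + k) z‖ :=
              mul_le_mul (Real.exp_le_exp.2 (neg_le_neg hpow)) ih (by positivity)
                (Real.exp_pos _).le
    have hlim : Tendsto (fun k => ‖φ (N + k) z‖) atTop (𝓝 ‖ψ z‖) :=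
      ((hψz z).comp (tendsto_atTop_mono (fun k => Nat.le_add_left k N) tendsto_id)).norm
    have hge : Real.exp (-2) * ‖φ N z‖ ≤ ‖ψ z‖ := by
      refine ge_of_tendsto' hlim fun k => le_trans ?_ (hbound k)
      gcongr
      exact le_mul_of_one_le_left (norm_nonneg _) (Real.one_le_exp (by positivity))
    have hpos' : 0 < Real.exp (-2) * ‖φ N z‖ :=
      mul_pos (Real.exp_pos _) (norm_pos_iff.2 ((hφ N).ne_zero z))
    rw [show ψ z = 0 from hz, norm_zero] at hge
    linarith
  · intro hz
    have h0 : Tendsto (fun n => φ n z) atTop (𝓝 0) :=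
      squeeze_zero_norm (fun n => (hφ n).le_on z hz)
        (tendsto_pow_atTop_nhds_zero_of_lt_one (by norm_num) (by norm_num))
    exact tendsto_nhds_unique (hψz z) h0

end
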